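/- arXiv:1905.07615 — 2 statements merged into one kernel-verified Lean document; each statement's English description precedes it below -/
import Mathlib

section
/- Let G be an edge-coloring of K_n with no rainbow triangle, equipped with a Gallai partition in which every part has order at most 3. If the Gallai partition has one part of order 3, another part of order at least 2, and there are at least six additional vertices outside these two parts, then G contains a monochromatic copy of C_8. -/
/-- The coloring `c` of the edges of the complete graph on `Fin n` contains a rainbow
triangle: three vertices whose three connecting edges receive three distinct colors. -/
def hasRainbowTriangle {n k : ℕ} (c : Sym2 (Fin n) → Fin k) : Prop :=
  ∃ a b d : Fin n, a ≠ b ∧ a ≠ d ∧ b ≠ d ∧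
    c s(a, b) ≠ c s(a, d) ∧ c s(a, b) ≠ c s(b, d) ∧ c s(a, d) ≠ c s(b, d)

/-- The coloring `c` contains a path on `m` vertices all of whose edges receive color `j`. -/
def hasMonoPath {n k : ℕ} (c : Sym2 (Fin n) → Fin k) (m : ℕ) (j : Fin k) : Prop :=
  ∃ v : Fin m → Fin n, Function.Injective v ∧
    ∀ (i : ℕ) (h : i + 1 < m),
      c s(v ⟨i, Nat.lt_of_succ_lt h⟩, v ⟨i + 1, h⟩) = j

/-- The coloring `c` contains a cycle on `m` vertices all of whose edges receive color `j`. -/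
def hasMonoCycle {n k : ℕ} (c : Sym2 (Fin n) → Fin k) (m : ℕ) (j : Fin k) : Prop :=
  ∃ v : Fin m → Fin n, Function.Injective v ∧
    ∀ i : Fin m, c s(v i, v ⟨(i.val + 1) % m, Nat.mod_lt _ i.pos⟩) = j

/-- `P` is a Gallai partition for the coloring `c`: a partition of the vertex set into at
least two parts such that between any two distinct parts all edges get a single color, and
at most two colors total appear between distinct parts. -/
def IsGallaiPartition {n k : ℕ} (c : Sym2 (Fin n) → Fin k)
    (P : Finpartition (Finset.univ : Finset (Fin n))) : Prop :=
  2 ≤ P.parts.card ∧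
  ∃ c1 c2 : Fin k, ∀ A ∈ P.parts, ∀ B ∈ P.parts, A ≠ B →
    (∀ a ∈ A, ∀ b ∈ B, c s(a, b) = c1) ∨ (∀ a ∈ A, ∀ b ∈ B, c s(a, b) = c2)

/-! Proof outline. We pick three vertices `0,1,2` of `A`, two vertices `3,4` of `B` and six further
vertices `5,…,10`, sorted by the part in which they lie. After a suitable reordering all edges
between `{5,6,7}` and `{8,9,10}`, except possibly `{7,8}`, run between distinct parts.
The resulting two-colouring of a reduced graph is handled by a verified decision tree.
-/

namespace C8Tree

/-- A decision tree: branch on the colour of a reduced edge, or exhibit a cycle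
(eight base-11 digits). -/
inductive DTree : Type
  | l : ℕ → DTree
  | n : ℕ → ℕ → DTree → DTree → DTree

/-- The representative of a vertex. -/
def rep (u : ℕ) : ℕ := if u < 3 then 0 else if u < 5 then 3 else u

/-- Ordered pairs of vertices whose edge certainly runs between different parts. -/
def adjLt (u w : ℕ) : Bool :=
  (decide (u < 3) && decide (3 ≤ w)) || (decide (u < 5) && decide (5 ≤ w)) ||
    (decide (u < 8) && decide (8 ≤ w) && !(decide (u = 7) && decide (w = 8)))

/-- The symmetric version of `adjLt`. -/
def adj (u w : ℕ) : Bool := adjLt u w || adjLt w u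

/-- The `i`-th vertex of an encoded cycle. -/
def dig (x i : ℕ) : ℕ := x / 11 ^ i % 11

/-- All edges of the encoded cycle are in the list. -/
def inList (x : ℕ) (L : List (ℕ × ℕ)) : Bool :=
  (List.range 8).all fun i =>
    L.contains (rep (dig x i), rep (dig x ((i + 1) % 8))) ||
      L.contains (rep (dig x ((i + 1) % 8)), rep (dig x i))

/-- The encoded cycle is a genuine cycle using allowed edges. -/
def okCycle (x : ℕ) : Bool :=
  (List.range 8).all fun i => adj (dig x i) (dig x ((i + 1) % 8)) &&
    (List.range 8).all fun j => decide (i = j) || !(decide (dig x i = dig x j))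

/-- The checker. -/
def check : DTree → List (ℕ × ℕ) → List (ℕ × ℕ) → Bool
  | .l x, pos, neg => okCycle x && (inList x pos || inList x neg)
  | .n u w s t, pos, neg => check s ((u, w) :: pos) neg && check t pos ((u, w) :: neg)

theorem inList_sound (col : ℕ → ℕ → Bool) (hsym : ∀ u w, col u w = col w u) (b : Bool)
    (L : List (ℕ × ℕ)) (hL : ∀ e ∈ L, col e.1 e.2 = b) (x : ℕ) (h : inList x L = true) :
    ∀ i < 8, col (rep (dig x i)) (rep (dig x ((i + 1) % 8))) = b := by
  intro i hi
  have h1 := List.all_eq_true.1 h i (List.mem_range.2 hi)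
  rw [Bool.or_eq_true, List.contains_iff_mem, List.contains_iff_mem] at h1
  rcases h1 with h1 | h1
  · exact hL _ h1
  · rw [hsym]; exact hL _ h1

theorem check_sound (col : ℕ → ℕ → Bool) (hsym : ∀ u w, col u w = col w u) (t : DTree) :
    ∀ pos neg : List (ℕ × ℕ), (∀ e ∈ pos, col e.1 e.2 = true) →
      (∀ e ∈ neg, col e.1 e.2 = false) → check t pos neg = true →
      ∃ b x, okCycle x = true ∧
        ∀ i < 8, col (rep (dig x i)) (rep (dig x ((i + 1) % 8))) = b := by
  induction t with
  | l x =>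
    intro pos neg hp hn h
    rw [check, Bool.and_eq_true, Bool.or_eq_true] at h
    rcases h with ⟨h0, h | h⟩
    · exact ⟨true, x, h0, inList_sound col hsym true pos hp x h⟩
    · exact ⟨false, x, h0, inList_sound col hsym false neg hn x h⟩
  | n u w s t ihs iht =>
    intro pos neg hp hn h
    rw [check, Bool.and_eq_true] at h
    cases hc : col u w with
    | true =>
      refine ihs _ neg ?_ hn h.1
      intro e he
      rcases List.mem_cons.1 he with rfl | he
      · exact hc
      · exact hp e he
    | false =>
      refine iht pos _ hp ?_ h.2
      intro e he
      rcases List.mem_cons.1 he with rfl | he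
      · exact hc
      · exact hn e he

open DTree in
set_option maxRecDepth 100000 in
/-- The decision tree. -/
def tree : DTree :=
  (n 0 3 (n 0 7 (n 0 6 (n 3 5 (l 140940228) (n 3 8 (l 140940591) (n 3 9 (l 140940712) (n 3 10 (l
  140940833) (n 0 5 (n 3 6 (l 140779298) (n 3 7 (l 121292248) (n 0 8 (n 7 9 (n 5 9 (l 153194261)
  (n 6 9 (l 153355312) (n 7 10 (n 5 10 (l 154965822) (n 6 10 (l 155126873) (n 5 8 (n 6 8 (l
  131935529) (l 205278032)) (l 207034952)))) (n 6 10 (n 5 10 (l 135478651) (l 164265192)) (l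
  164266512))))) (n 5 10 (n 6 10 (l 135478651) (n 7 10 (l 154965822) (n 6 8 (n 5 8 (l 131935529)
  (l 189490172)) (l 189495012)))) (n 6 8 (n 5 8 (l 131935529) (n 7 10 (n 6 10 (l 155126873) (l
  188554732)) (l 189480382))) (n 6 9 (n 5 9 (l 133707090) (l 205287822)) (l 168085272))))) (n 0 9
  (n 0 10 (n 7 9 (n 5 9 (l 153194261) (n 6 9 (l 153355312) (n 7 10 (l 208756856) (n 5 10 (l
  188260787) (l 164265192))))) (n 7 10 (n 5 10 (l 154965822) (n 6 10 (l 155126873) (n 5 9 (l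
  207733317) (l 164250672)))) (n 5 9 (n 6 9 (l 133707090) (n 5 10 (l 205213734) (l 164092272))) (n
  6 10 (n 5 10 (l 135478651) (n 6 9 (l 206985295) (l 164092272))) (l 164106792))))) (n 7 10 (n 5
  10 (l 154965822) (n 6 10 (l 155126873) (n 6 9 (n 5 9 (l 133707090) (l 205245975)) (l
  207016205)))) (n 7 9 (n 5 9 (l 153194261) (l 208055716)) (l 208787766)))) (n 0 10 (n 7 9 (n 5 9
  (l 153194261) (n 6 9 (l 153355312) (n 6 10 (n 5 10 (l 135478651) (l 185919855)) (l 187690085))))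
  (n 7 10 (n 5 10 (l 154965822) (l 188583186)) (l 189461646))) (l 202819320)))))) (n 0 8 (n 3 6 (l
  160588571) (n 3 7 (l 160427641) (n 0 9 (n 0 10 (n 5 8 (n 5 9 (l 185565512) (n 5 10 (l 205052683)
  (n 6 8 (n 6 9 (l 187337073) (n 6 10 (l 206824244) (n 7 9 (l 188232836) (l 164251992)))) (n 6 9
  (n 7 9 (l 153355312) (l 205287822)) (l 205278032))))) (n 7 9 (n 6 9 (l 153355312) (n 7 10 (l
  208756856) (n 6 8 (l 188232836) (l 208057622)))) (n 6 8 (n 6 9 (l 187337073) (n 6 10 (l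
  206824244) (l 207059372))) (n 6 9 (n 6 10 (l 206985295) (l 188585092)) (l 203226092))))) (n 6 10
  (n 7 10 (l 155126873) (n 7 9 (n 6 9 (l 153355312) (l 208057014)) (l 208789064))) (n 6 8 (n 6 9
  (l 187337073) (l 207018834)) (l 206857783)))) (n 0 10 (n 6 9 (n 7 9 (l 153355312) (n 7 10 (n 6
  10 (l 155126873) (l 188584484)) (l 189462944))) (n 6 8 (n 6 10 (l 206824244) (l 187692714)) (l
  187370612))) (l 202980338))))) (n 0 10 (n 3 6 (l 199562913) (n 3 7 (l 199401983) (n 0 9 (n 6 9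
  (n 7 9 (l 153355312) (n 6 10 (l 206985295) (n 7 10 (l 207734648) (l 164265783)))) (n 6 8 (n 5 9
  (n 5 10 (l 205213734) (l 164526175)) (l 164164022)) (l 168044492))) (l 183491836)))) (l
  203462160)))))))) (n 0 9 (n 3 5 (l 180075621) (n 3 6 (l 180075742) (n 3 8 (l 180075984) (n 3 10
  (l 180076226) (n 0 10 (n 3 7 (l 199885136) (n 3 9 (l 199563276) (n 0 8 (n 0 5 (n 6 8 (n 6 9 (l
  187337073) (n 6 10 (l 206824244) (n 5 8 (n 5 9 (l 185565512) (n 5 10 (l 205052683) (n 7 9 (l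
  188231505) (l 164251992)))) (n 5 9 (n 7 9 (l 153194261) (l 207059372)) (l 207034952))))) (n 7 9
  (n 5 9 (l 153194261) (n 7 10 (l 208756856) (n 5 8 (l 188231505) (l 208056302)))) (n 5 8 (n 5 9
  (l 185565512) (n 5 10 (l 205052683) (l 205287822))) (n 6 9 (n 6 10 (l 206985295) (l 188585092))
  (l 203226092))))) (n 5 9 (n 5 8 (l 185565512) (n 5 10 (l 205213734) (n 6 9 (n 6 8 (l 187337073)
  (l 131847463)) (l 133618782)))) (n 6 8 (n 6 9 (l 187337073) (n 6 10 (l 206824244) (l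
  135390464))) (l 131847342)))) (n 0 5 (n 5 9 (n 7 9 (l 153194261) (n 5 10 (l 205213734) (n 7 10
  (l 207733317) (l 164264463)))) (n 5 8 (n 6 9 (n 6 10 (l 206985295) (l 164511545)) (l 164162702))
  (l 166272942))) (l 164163054))))) (n 0 5 (n 3 7 (l 179753761) (n 3 9 (l 140779661) (n 0 8 (n 5
  10 (n 7 10 (l 154965822) (n 7 9 (n 5 9 (l 153194261) (l 208055694)) (l 208787744))) (n 5 8 (n 5
  9 (l 185565512) (l 205247284)) (l 205086233))) (l 202817967)))) (l 203298447))))))) (n 0 10 (n 3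
  5 (l 199562792) (n 3 6 (l 199562913) (n 3 8 (l 199563155) (n 3 9 (l 199563276) (n 0 5 (n 3 7 (l
  199240932) (n 3 10 (l 140779782) (n 0 8 (n 5 9 (n 7 9 (l 153194261) (n 7 10 (n 5 10 (l
  154965822) (l 188583164)) (l 189461624))) (n 5 8 (n 5 10 (l 205052683) (l 185921164)) (l
  185599062))) (l 183330796)))) (l 183811276)))))) (n 0 8 (n 3 5 (l 160588450) (n 3 6 (l
  160588571) (n 3 9 (l 160588934) (l 198158378)))) (n 0 5 (n 3 6 (l 140779298) (n 3 8 (l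
  140779540) (l 199890009))) (n 3 8 (n 3 9 (n 6 8 (n 6 9 (l 138966718) (n 6 10 (n 7 10 (l
  155214719) (n 3 10 (l 138981359) (n 7 9 (n 3 6 (n 3 5 (n 5 8 (l 138925094) (l 199954491)) (l
  160435165)) (l 161103085)) (l 208759540)))) (l 206990641))) (n 6 9 (n 6 10 (n 7 10 (l 155229360)
  (n 3 10 (l 138981480) (n 7 9 (n 3 6 (n 3 5 (n 5 9 (l 138926425) (l 199793561)) (l 160435165)) (l
  161103085)) (l 208759540)))) (l 180636841)) (l 199962961))) (n 3 10 (n 3 6 (n 3 5 (n 5 10 (n 6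
  10 (l 138927756) (n 5 8 (l 138980028) (l 180628371))) (n 6 10 (n 6 8 (l 138981359) (l
  180306511)) (l 180239961))) (l 160433834)) (l 160942034)) (l 201673296))) (n 3 9 (n 3 10 (n 3 6
  (n 3 5 (n 5 10 (n 6 10 (l 138927756) (n 5 9 (l 138980149) (l 161141321))) (n 6 10 (n 6 9 (l
  138981480) (l 160980391)) (l 180239961))) (l 179919674)) (l 180268154)) (l 201512245)) (l
  182025074)))))))) (n 0 8 (n 0 9 (n 3 5 (l 180236672) (n 3 6 (l 180236793) (n 3 7 (l 180236914)
  (n 3 10 (l 180237277) (n 0 10 (n 3 8 (l 199885257) (n 3 9 (l 199724327) (n 0 5 (n 0 6 (n 5 8 (n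
  6 8 (l 131935529) (n 5 9 (l 185565512) (n 5 10 (l 205052683) (n 6 9 (l 186459944) (l
  205278032))))) (n 6 8 (n 6 9 (l 187337073) (n 6 10 (l 206824244) (n 5 9 (l 166987414) (l
  207034952)))) (n 5 9 (n 6 9 (l 133707090) (n 5 10 (l 205213734) (l 205118312))) (n 7 9 (n 7 10
  (l 208756856) (l 208056302)) (l 203224772))))) (n 6 8 (n 6 9 (l 187337073) (n 6 10 (l 206824244)
  (n 7 10 (n 7 9 (l 208756856) (l 153076924)) (l 154848364)))) (n 7 9 (n 7 10 (l 208756856) (l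
  154848243)) (l 153076682)))) (n 0 6 (n 5 8 (n 5 9 (l 185565512) (n 5 10 (l 205052683) (n 7 10 (n
  7 9 (l 208756856) (l 153091554)) (l 154862994)))) (n 7 9 (n 7 10 (l 208756856) (l 154862873)) (l
  153091312))) (l 144836934))))) (n 0 5 (n 3 8 (l 179753882) (n 3 9 (l 160266832) (n 0 6 (n 5 9 (n
  6 9 (l 133707090) (n 5 8 (l 185565512) (n 6 8 (l 166987414) (l 203048483)))) (n 5 10 (n 6 10 (l
  135478651) (l 206284144)) (l 205245964))) (l 202816636)))) (l 202977676))))))) (n 0 6 (n 3 5 (l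
  160427399) (n 3 7 (l 160427641) (n 3 9 (l 160427883) (n 3 10 (l 160428004) (n 0 5 (n 3 6 (l
  160266469) (n 3 8 (l 121292369) (n 0 10 (n 5 10 (n 6 10 (l 135478651) (n 5 8 (l 205052683) (n 6
  8 (l 167002055) (l 183561312)))) (n 5 9 (n 6 9 (l 133707090) (l 186811614)) (l 185919844))) (l
  202819309)))) (l 184134709)))))) (n 0 5 (n 3 6 (l 160266469) (n 3 7 (l 160266590) (n 3 9 (l
  160266832) (n 3 10 (l 160266953) (l 184134720))))) (n 0 10 (n 3 5 (l 199723843) (n 3 6 (l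
  199723964) (l 180078063))) (n 3 7 (n 3 5 (n 7 9 (n 5 9 (l 158428237) (n 6 9 (n 6 8 (l 168084158)
  (n 3 6 (l 158428358) (n 3 9 (n 3 10 (n 6 10 (l 158468651) (l 141654150)) (l 141615914)) (l
  141454863)))) (l 199565960))) (n 7 10 (n 5 10 (l 158429568) (l 188198010)) (l 208759540))) (n 3
  6 (n 3 9 (n 3 10 (n 6 9 (n 7 9 (l 158428358) (n 6 10 (l 158468651) (l 188262140))) (n 7 9 (n 7
  10 (l 158469982) (l 207734670)) (l 199682120))) (l 140947994)) (l 140946663)) (l 180078063))) (n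
  3 9 (n 3 10 (n 3 6 (n 3 5 (n 5 9 (n 6 9 (l 158413596) (n 5 10 (l 158467320) (l 141493220))) (n 6
  9 (n 6 10 (l 158468651) (l 141654150)) (l 199565960))) (l 179918343)) (l 180107103)) (l
  201351194)) (l 181864023))))))) (n 0 9 (n 0 5 (n 3 6 (l 179753640) (n 3 7 (l 179753761) (n 3 8
  (l 179753882) (n 3 10 (l 179754124) (n 0 6 (n 3 5 (l 179914570) (n 3 9 (l 121292490) (n 0 10 (n
  5 9 (n 6 9 (l 133707090) (n 5 10 (l 205213734) (n 6 10 (l 205961756) (l 164103423)))) (n 5 8 (n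
  6 8 (l 131935529) (l 167309802)) (l 166271622))) (l 202817978)))) (l 164647549)))))) (n 0 6 (n 3
  5 (l 179914570) (n 3 7 (l 179914812) (n 3 8 (l 179914933) (n 3 10 (l 179915175) (l
  164647538))))) (n 0 10 (n 3 5 (l 199884894) (n 3 6 (l 199885015) (l 160590892))) (n 3 5 (n 3 6
  (n 6 10 (n 5 10 (l 177902098) (n 7 10 (n 7 9 (l 189489300) (n 3 7 (l 177916860) (n 3 8 (n 3 10
  (n 6 8 (l 177955701) (l 141332169)) (l 201351194)) (l 162376852)))) (l 160432019))) (n 7 10 (n 6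
  8 (n 5 8 (l 177899436) (l 141654029)) (l 206828259)) (l 160722419))) (n 3 7 (n 3 8 (n 3 10 (n 5
  10 (n 7 10 (l 177916739) (n 5 8 (l 177954370) (l 207684939))) (n 6 10 (n 6 8 (l 177955701) (l
  141332169)) (l 160591739))) (l 141615914)) (l 141293812)) (l 160619932))) (n 3 6 (n 3 7 (n 3 8
  (n 3 10 (n 6 10 (n 7 10 (l 177916860) (n 6 8 (l 177955701) (l 207720029))) (n 7 10 (n 6 8 (n 5
  10 (n 5 9 (l 185960819) (n 5 8 (l 177954370) (l 141654029))) (l 160591739)) (l 206828259)) (l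
  160722419))) (l 140947994)) (l 140945332)) (l 160431172)) (l 160590892)))))) (n 0 10 (n 0 6 (n 3
  5 (l 199401741) (n 3 7 (l 199401983) (n 3 8 (l 199402104) (l 178510167)))) (n 0 5 (n 3 6 (l
  199240811) (n 3 7 (l 199240932) (l 180240456))) (n 3 5 (n 3 6 (n 6 9 (n 5 9 (l 197387938) (n 7 9
  (n 7 10 (l 208815420) (n 3 7 (l 197402700) (n 3 8 (n 3 9 (n 6 8 (l 197428231) (l 141332048)) (l
  181864023)) (l 162376852)))) (l 160431898))) (n 7 9 (n 6 8 (n 5 8 (l 197386607) (l 141492978))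
  (l 187341088)) (l 160707778))) (n 3 7 (n 3 8 (n 3 9 (n 5 9 (n 7 9 (l 197402579) (n 5 8 (l
  197426900) (l 188197768))) (n 6 9 (n 6 8 (l 197428231) (l 141332048)) (l 160591618))) (l
  141454863)) (l 141293812)) (l 160619932))) (n 3 6 (n 3 7 (n 3 8 (n 3 9 (n 6 9 (n 7 9 (l
  197402700) (n 6 8 (l 197428231) (l 188232858))) (n 7 9 (n 6 8 (n 5 9 (n 5 10 (l 205286939) (n 5
  8 (l 197426900) (l 141492978))) (l 160591618)) (l 187341088)) (l 160707778))) (l 140946663)) (l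
  140945332)) (l 160431172)) (l 160590892))))) (n 0 6 (n 0 5 (n 3 7 (l 121292248) (n 3 8 (l
  121292369) (l 199890020))) (n 3 9 (n 3 10 (n 5 9 (n 5 10 (l 119492978) (n 7 10 (n 7 9 (l
  119495640) (l 160995032)) (l 180241292))) (n 7 9 (n 7 10 (l 119495640) (l 161155962)) (l
  199728342))) (n 3 8 (n 3 7 (n 3 5 (n 5 9 (n 7 9 (l 119453895) (n 5 8 (l 119478216) (l
  199969132))) (n 7 9 (n 5 10 (n 7 10 (l 119455226) (l 161155962)) (l 205219102)) (l 199728342)))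
  (l 160596216)) (l 161104416)) (l 201513576))) (n 3 8 (n 3 10 (n 3 7 (n 3 5 (n 5 10 (n 7 10 (l
  119455226) (n 5 8 (l 119492857) (l 180643012))) (n 7 10 (n 5 9 (n 7 9 (l 119453895) (l
  160995032)) (l 205219102)) (l 180241292))) (l 160594885)) (l 160943365)) (l 201674627)) (l
  182026405)))) (n 0 5 (n 3 9 (n 3 10 (n 6 9 (n 6 10 (l 100007138) (n 7 10 (n 7 9 (l 100008469) (l
  160995043)) (l 180241303))) (n 7 9 (n 7 10 (l 100008469) (l 161155973)) (l 199728353))) (n 3 8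
  (n 3 7 (n 3 6 (n 6 9 (n 7 9 (l 99966845) (n 6 8 (l 99992376) (l 199969143))) (n 7 9 (n 6 10 (n 7
  10 (l 99968176) (l 161155973)) (l 206990663)) (l 199728353))) (l 160596227)) (l 161104427)) (l
  201513587))) (n 3 8 (n 3 10 (n 3 7 (n 3 6 (n 6 10 (n 7 10 (l 99968176) (n 6 8 (l 100007017) (l
  180643023))) (n 7 10 (n 6 9 (n 7 9 (l 99966845) (l 160995043)) (l 206990663)) (l 180241303))) (l
  160594896)) (l 160943376)) (l 201674638)) (l 182026416))) (n 3 7 (n 3 5 (n 6 9 (n 6 10 (n 7 9 (n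
  5 10 (l 91900864) (n 7 10 (n 5 8 (n 5 9 (l 92060584) (l 205217760)) (l 205056709)) (l
  160432019))) (n 7 10 (n 5 9 (l 92060584) (l 160431898)) (l 208759540))) (n 7 10 (n 6 8 (n 5 10
  (n 7 9 (n 5 8 (l 91898202) (l 141654029)) (l 188262140)) (l 160591739)) (l 206828259)) (l
  160722419))) (n 7 9 (n 6 8 (n 6 10 (n 5 9 (n 7 10 (n 5 8 (l 92059253) (l 141492978)) (l
  207734670)) (l 160591618)) (l 206989310)) (l 187341088)) (l 160707778))) (n 3 6 (n 3 8 (n 3 9 (n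
  3 10 (n 5 8 (n 5 9 (n 6 10 (n 6 9 (l 96770025) (n 7 9 (l 166313722) (l 160707778))) (n 7 10 (n 6
  8 (l 208056302) (l 206828259)) (l 160722419))) (n 6 9 (n 7 9 (n 5 10 (l 205086962) (l
  205217760)) (l 160431898)) (l 160591618))) (n 6 8 (n 5 9 (n 5 10 (n 6 9 (l 96610305) (l
  141492978)) (l 205056709)) (l 185569538)) (l 180078668))) (l 140947994)) (l 140946663)) (l
  140945332)) (l 160590892))) (n 3 8 (n 3 9 (n 3 10 (n 3 6 (n 3 5 (n 7 9 (n 7 10 (n 6 8 (n 6 9 (l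
  96932407) (n 6 10 (l 95175487) (l 206989310))) (n 6 9 (n 6 10 (n 5 8 (l 208816292) (l
  180078668)) (l 206828259)) (l 187341088))) (n 6 10 (n 5 10 (n 6 8 (n 5 9 (l 94853385) (l
  207685060)) (l 207720029)) (l 160432019)) (l 160722419))) (n 7 10 (n 6 9 (n 5 9 (n 6 8 (n 5 10
  (l 96610305) (l 188198010)) (l 188232858)) (l 160431898)) (l 160707778)) (l 208759540))) (l
  160431172)) (l 160619932)) (l 201351194)) (l 181864023)) (l 162376852))))))))) (n 0 7 (n 0 8 (n
  0 9 (n 0 10 (n 0 6 (n 0 5 (n 3 7 (n 3 8 (l 162376852) (n 3 9 (l 181864023) (n 3 10 (l 201351194)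
  (n 3 6 (l 160619932) (n 3 5 (l 160431172) (n 7 9 (n 7 10 (l 208759540) (n 6 9 (l 160707778) (n 5
  9 (l 160431898) (n 6 8 (l 188232858) (n 5 10 (l 188198010) (l 96610305)))))) (n 7 10 (n 6 10 (l
  160722419) (n 5 10 (l 160432019) (n 6 8 (l 207720029) (n 5 9 (l 207685060) (l 94853385))))) (n 6
  8 (n 6 9 (l 187341088) (n 6 10 (l 206828259) (n 5 8 (l 180078668) (l 208816292)))) (n 6 9 (n 6
  10 (l 206989310) (l 95175487)) (l 96932407)))))))))) (n 3 5 (n 3 6 (l 160590892) (n 3 8 (l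
  140945332) (n 3 9 (l 140946663) (n 3 10 (l 140947994) (n 5 8 (n 6 8 (l 180078668) (n 5 9 (l
  185569538) (n 5 10 (l 205056709) (n 6 9 (l 141492978) (l 96610305))))) (n 5 9 (n 6 9 (l
  160591618) (n 7 9 (l 160431898) (n 5 10 (l 205217760) (l 205086962)))) (n 6 10 (n 7 10 (l
  160722419) (n 6 8 (l 206828259) (l 208056302))) (n 6 9 (n 7 9 (l 160707778) (l 166313722)) (l
  96770025))))))))) (n 6 9 (n 7 9 (l 160707778) (n 6 8 (l 187341088) (n 6 10 (l 206989310) (n 5 9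
  (l 160591618) (n 7 10 (l 207734670) (n 5 8 (l 141492978) (l 92059253))))))) (n 6 10 (n 7 10 (l
  160722419) (n 6 8 (l 206828259) (n 5 10 (l 160591739) (n 7 9 (l 188262140) (n 5 8 (l 141654029)
  (l 91898202)))))) (n 7 9 (n 7 10 (l 208759540) (n 5 9 (l 160431898) (l 92060584))) (n 5 10 (n 7
  10 (l 160432019) (n 5 8 (l 205056709) (n 5 9 (l 205217760) (l 92060584)))) (l 91900864))))))) (n
  3 9 (n 3 8 (l 182026416) (n 3 10 (l 201674638) (n 3 7 (l 160943376) (n 3 6 (l 160594896) (n 6 10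
  (n 7 10 (l 180241303) (n 6 9 (l 206990663) (n 7 9 (l 160995043) (l 99966845)))) (n 7 10 (n 6 8
  (l 180643023) (l 100007017)) (l 99968176))))))) (n 3 10 (n 3 8 (l 201513587) (n 3 7 (l
  161104427) (n 3 6 (l 160596227) (n 6 9 (n 7 9 (l 199728353) (n 6 10 (l 206990663) (n 7 10 (l
  161155973) (l 99968176)))) (n 7 9 (n 6 8 (l 199969143) (l 99992376)) (l 99966845)))))) (n 6 9 (n
  7 9 (l 199728353) (n 7 10 (l 161155973) (l 100008469))) (n 6 10 (n 7 10 (l 180241303) (n 7 9 (l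
  160995043) (l 100008469))) (l 100007138)))))) (n 0 5 (n 3 9 (n 3 8 (l 182026405) (n 3 10 (l
  201674627) (n 3 7 (l 160943365) (n 3 5 (l 160594885) (n 5 10 (n 7 10 (l 180241292) (n 5 9 (l
  205219102) (n 7 9 (l 160995032) (l 119453895)))) (n 7 10 (n 5 8 (l 180643012) (l 119492857)) (l
  119455226))))))) (n 3 10 (n 3 8 (l 201513576) (n 3 7 (l 161104416) (n 3 5 (l 160596216) (n 5 9
  (n 7 9 (l 199728342) (n 5 10 (l 205219102) (n 7 10 (l 161155962) (l 119455226)))) (n 7 9 (n 5 8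
  (l 199969132) (l 119478216)) (l 119453895)))))) (n 5 9 (n 7 9 (l 199728342) (n 7 10 (l
  161155962) (l 119495640))) (n 5 10 (n 7 10 (l 180241292) (n 7 9 (l 160995032) (l 119495640))) (l
  119492978))))) (n 3 7 (n 3 8 (l 199890020) (l 121292369)) (l 121292248)))) (n 0 6 (n 0 5 (n 3 5
  (n 3 6 (l 160590892) (n 3 7 (l 160431172) (n 3 8 (l 140945332) (n 3 9 (l 140946663) (n 6 9 (n 7
  9 (l 160707778) (n 6 8 (l 187341088) (n 5 9 (l 160591618) (n 5 10 (n 5 8 (l 141492978) (l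
  197426900)) (l 205286939))))) (n 7 9 (n 6 8 (l 188232858) (l 197428231)) (l 197402700))))))) (n
  3 6 (n 3 7 (l 160619932) (n 3 8 (l 141293812) (n 3 9 (l 141454863) (n 5 9 (n 6 9 (l 160591618)
  (n 6 8 (l 141332048) (l 197428231))) (n 7 9 (n 5 8 (l 188197768) (l 197426900)) (l
  197402579)))))) (n 6 9 (n 7 9 (l 160707778) (n 6 8 (l 187341088) (n 5 8 (l 141492978) (l
  197386607)))) (n 5 9 (n 7 9 (l 160431898) (n 7 10 (n 3 7 (n 3 8 (l 162376852) (n 3 9 (l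
  181864023) (n 6 8 (l 141332048) (l 197428231)))) (l 197402700)) (l 208815420))) (l
  197387938))))) (n 3 6 (n 3 7 (l 180240456) (l 199240932)) (l 199240811))) (n 3 5 (n 3 7 (n 3 8
  (l 178510167) (l 199402104)) (l 199401983)) (l 199401741)))) (n 0 5 (n 0 6 (n 0 10 (n 3 5 (n 3 6
  (l 160590892) (n 3 7 (l 160431172) (n 3 8 (l 140945332) (n 3 10 (l 140947994) (n 6 10 (n 7 10 (l
  160722419) (n 6 8 (l 206828259) (n 5 10 (l 160591739) (n 5 9 (n 5 8 (l 141654029) (l 177954370))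
  (l 185960819))))) (n 7 10 (n 6 8 (l 207720029) (l 177955701)) (l 177916860))))))) (n 3 6 (n 3 7
  (l 160619932) (n 3 8 (l 141293812) (n 3 10 (l 141615914) (n 5 10 (n 6 10 (l 160591739) (n 6 8 (l
  141332169) (l 177955701))) (n 7 10 (n 5 8 (l 207684939) (l 177954370)) (l 177916739)))))) (n 6
  10 (n 7 10 (l 160722419) (n 6 8 (l 206828259) (n 5 8 (l 141654029) (l 177899436)))) (n 5 10 (n 7
  10 (l 160432019) (n 7 9 (n 3 7 (n 3 8 (l 162376852) (n 3 10 (l 201351194) (n 6 8 (l 141332169)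
  (l 177955701)))) (l 177916860)) (l 189489300))) (l 177902098))))) (n 3 5 (n 3 6 (l 160590892) (l
  199885015)) (l 199884894))) (n 3 5 (n 3 7 (n 3 8 (n 3 10 (l 164647538) (l 179915175)) (l
  179914933)) (l 179914812)) (l 179914570))) (n 3 6 (n 3 7 (n 3 8 (n 3 10 (n 0 6 (l 164647549) (n
  3 5 (n 3 9 (n 0 10 (l 202817978) (n 5 9 (n 5 8 (l 166271622) (n 6 8 (l 167309802) (l
  131935529))) (n 6 9 (n 5 10 (n 6 10 (l 164103423) (l 205961756)) (l 205213734)) (l 133707090))))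
  (l 121292490)) (l 179914570))) (l 179754124)) (l 179753882)) (l 179753761)) (l 179753640)))) (n
  0 9 (n 0 6 (n 0 5 (n 0 10 (n 3 7 (n 3 9 (l 181864023) (n 3 10 (l 201351194) (n 3 6 (l 180107103)
  (n 3 5 (l 179918343) (n 5 9 (n 6 9 (l 199565960) (n 6 10 (l 141654150) (l 158468651))) (n 6 9 (n
  5 10 (l 141493220) (l 158467320)) (l 158413596))))))) (n 3 5 (n 3 6 (l 180078063) (n 3 9 (l
  140946663) (n 3 10 (l 140947994) (n 6 9 (n 7 9 (l 199682120) (n 7 10 (l 207734670) (l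
  158469982))) (n 7 9 (n 6 10 (l 188262140) (l 158468651)) (l 158428358)))))) (n 7 9 (n 7 10 (l
  208759540) (n 5 10 (l 188198010) (l 158429568))) (n 5 9 (n 6 9 (l 199565960) (n 6 8 (n 3 6 (n 3
  9 (l 141454863) (n 3 10 (l 141615914) (n 6 10 (l 141654150) (l 158468651)))) (l 158428358)) (l
  168084158))) (l 158428237))))) (n 3 5 (n 3 6 (l 180078063) (l 199723964)) (l 199723843))) (n 3 6
  (n 3 7 (n 3 9 (n 3 10 (l 184134720) (l 160266953)) (l 160266832)) (l 160266590)) (l 160266469)))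
  (n 3 5 (n 3 7 (n 3 9 (n 3 10 (n 0 5 (l 184134709) (n 3 6 (n 3 8 (n 0 10 (l 202819309) (n 5 10 (n
  5 9 (l 185919844) (n 6 9 (l 186811614) (l 133707090))) (n 6 10 (n 5 8 (n 6 8 (l 183561312) (l
  167002055)) (l 205052683)) (l 135478651)))) (l 121292369)) (l 160266469))) (l 160428004)) (l
  160427883)) (l 160427641)) (l 160427399))) (n 3 5 (n 3 6 (n 3 7 (n 3 10 (n 0 10 (n 0 5 (l
  202977676) (n 3 8 (n 3 9 (n 0 6 (l 202816636) (n 5 9 (n 5 10 (l 205245964) (n 6 10 (l 206284144)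
  (l 135478651))) (n 6 9 (n 5 8 (n 6 8 (l 203048483) (l 166987414)) (l 185565512)) (l
  133707090)))) (l 160266832)) (l 179753882))) (n 3 8 (n 3 9 (n 0 5 (n 0 6 (l 144836934) (n 5 8 (n
  7 9 (l 153091312) (n 7 10 (l 154862873) (l 208756856))) (n 5 9 (n 5 10 (n 7 10 (l 154862994) (n
  7 9 (l 153091554) (l 208756856))) (l 205052683)) (l 185565512)))) (n 0 6 (n 6 8 (n 7 9 (l
  153076682) (n 7 10 (l 154848243) (l 208756856))) (n 6 9 (n 6 10 (n 7 10 (l 154848364) (n 7 9 (l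
  153076924) (l 208756856))) (l 206824244)) (l 187337073))) (n 5 8 (n 6 8 (n 5 9 (n 7 9 (l
  203224772) (n 7 10 (l 208056302) (l 208756856))) (n 6 9 (n 5 10 (l 205118312) (l 205213734)) (l
  133707090))) (n 6 9 (n 6 10 (n 5 9 (l 207034952) (l 166987414)) (l 206824244)) (l 187337073)))
  (n 6 8 (n 5 9 (n 5 10 (n 6 9 (l 205278032) (l 186459944)) (l 205052683)) (l 185565512)) (l
  131935529))))) (l 199724327)) (l 199885257))) (l 180237277)) (l 180236914)) (l 180236793)) (l
  180236672)))) (n 0 6 (n 0 9 (n 0 10 (n 0 8 (n 0 5 (n 3 8 (n 3 9 (l 182025074) (n 3 10 (l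
  201512245) (n 3 6 (l 180268154) (n 3 5 (l 179919674) (n 5 10 (n 6 10 (l 180239961) (n 6 9 (l
  160980391) (l 138981480))) (n 6 10 (n 5 9 (l 161141321) (l 138980149)) (l 138927756))))))) (n 3
  9 (n 3 10 (l 201673296) (n 3 6 (l 160942034) (n 3 5 (l 160433834) (n 5 10 (n 6 10 (l 180239961)
  (n 6 8 (l 180306511) (l 138981359))) (n 6 10 (n 5 8 (l 180628371) (l 138980028)) (l
  138927756)))))) (n 6 8 (n 6 9 (l 199962961) (n 6 10 (l 180636841) (n 7 10 (n 3 10 (n 7 9 (l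
  208759540) (n 3 6 (l 161103085) (n 3 5 (l 160435165) (n 5 9 (l 199793561) (l 138926425))))) (l
  138981480)) (l 155229360)))) (n 6 9 (n 6 10 (l 206990641) (n 7 10 (n 3 10 (n 7 9 (l 208759540)
  (n 3 6 (l 161103085) (n 3 5 (l 160435165) (n 5 8 (l 199954491) (l 138925094))))) (l 138981359))
  (l 155214719))) (l 138966718))))) (n 3 6 (n 3 8 (l 199890009) (l 140779540)) (l 140779298))) (n
  3 5 (n 3 6 (n 3 9 (l 198158378) (l 160588934)) (l 160588571)) (l 160588450))) (n 3 5 (n 3 6 (n 3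
  8 (n 3 9 (n 0 5 (l 183811276) (n 3 7 (n 3 10 (n 0 8 (l 183330796) (n 5 9 (n 5 8 (l 185599062) (n
  5 10 (l 185921164) (l 205052683))) (n 7 9 (n 7 10 (l 189461624) (n 5 10 (l 188583164) (l
  154965822))) (l 153194261)))) (l 140779782)) (l 199240932))) (l 199563276)) (l 199563155)) (l
  199562913)) (l 199562792))) (n 3 5 (n 3 6 (n 3 8 (n 3 10 (n 0 10 (n 0 5 (l 203298447) (n 3 7 (n
  3 9 (n 0 8 (l 202817967) (n 5 10 (n 5 8 (l 205086233) (n 5 9 (l 205247284) (l 185565512))) (n 7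
  10 (n 7 9 (l 208787744) (n 5 9 (l 208055694) (l 153194261))) (l 154965822)))) (l 140779661)) (l
  179753761))) (n 3 7 (n 3 9 (n 0 8 (n 0 5 (l 164163054) (n 5 9 (n 5 8 (l 166272942) (n 6 9 (l
  164162702) (n 6 10 (l 164511545) (l 206985295)))) (n 7 9 (n 5 10 (n 7 10 (l 164264463) (l
  207733317)) (l 205213734)) (l 153194261)))) (n 0 5 (n 5 9 (n 6 8 (l 131847342) (n 6 9 (n 6 10 (l
  135390464) (l 206824244)) (l 187337073))) (n 5 8 (n 5 10 (n 6 9 (l 133618782) (n 6 8 (l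
  131847463) (l 187337073))) (l 205213734)) (l 185565512))) (n 6 8 (n 7 9 (n 5 8 (n 6 9 (l
  203226092) (n 6 10 (l 188585092) (l 206985295))) (n 5 9 (n 5 10 (l 205287822) (l 205052683)) (l
  185565512))) (n 5 9 (n 7 10 (n 5 8 (l 208056302) (l 188231505)) (l 208756856)) (l 153194261)))
  (n 6 9 (n 6 10 (n 5 8 (n 5 9 (l 207034952) (n 7 9 (l 207059372) (l 153194261))) (n 5 9 (n 5 10
  (n 7 9 (l 164251992) (l 188231505)) (l 205052683)) (l 185565512))) (l 206824244)) (l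
  187337073))))) (l 199563276)) (l 199885136))) (l 180076226)) (l 180075984)) (l 180075742)) (l
  180075621))) (n 3 5 (n 3 8 (n 3 9 (n 3 10 (n 0 5 (n 0 8 (n 0 10 (l 203462160) (n 3 6 (n 3 7 (n 0
  9 (l 183491836) (n 6 9 (n 6 8 (l 168044492) (n 5 9 (l 164164022) (n 5 10 (l 164526175) (l
  205213734)))) (n 7 9 (n 6 10 (n 7 10 (l 164265783) (l 207734648)) (l 206985295)) (l
  153355312)))) (l 199401983)) (l 199562913))) (n 3 6 (n 3 7 (n 0 9 (n 0 10 (l 202980338) (n 6 9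
  (n 6 8 (l 187370612) (n 6 10 (l 187692714) (l 206824244))) (n 7 9 (n 7 10 (l 189462944) (n 6 10
  (l 188584484) (l 155126873))) (l 153355312)))) (n 0 10 (n 6 10 (n 6 8 (l 206857783) (n 6 9 (l
  207018834) (l 187337073))) (n 7 10 (n 7 9 (l 208789064) (n 6 9 (l 208057014) (l 153355312))) (l
  155126873))) (n 5 8 (n 7 9 (n 6 8 (n 6 9 (l 203226092) (n 6 10 (l 188585092) (l 206985295))) (n
  6 9 (n 6 10 (l 207059372) (l 206824244)) (l 187337073))) (n 6 9 (n 7 10 (n 6 8 (l 208057622) (l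
  188232836)) (l 208756856)) (l 153355312))) (n 5 9 (n 5 10 (n 6 8 (n 6 9 (l 205278032) (n 7 9 (l
  205287822) (l 153355312))) (n 6 9 (n 6 10 (n 7 9 (l 164251992) (l 188232836)) (l 206824244)) (l
  187337073))) (l 205052683)) (l 185565512))))) (l 160427641)) (l 160588571))) (n 3 6 (n 3 7 (n 0
  8 (n 0 9 (n 0 10 (l 202819320) (n 7 9 (n 7 10 (l 189461646) (n 5 10 (l 188583186) (l
  154965822))) (n 5 9 (n 6 9 (n 6 10 (l 187690085) (n 5 10 (l 185919855) (l 135478651))) (l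
  153355312)) (l 153194261)))) (n 0 10 (n 7 10 (n 7 9 (l 208787766) (n 5 9 (l 208055716) (l
  153194261))) (n 5 10 (n 6 10 (n 6 9 (l 207016205) (n 5 9 (l 205245975) (l 133707090))) (l
  155126873)) (l 154965822))) (n 7 9 (n 7 10 (n 5 9 (n 6 10 (l 164106792) (n 5 10 (n 6 9 (l
  164092272) (l 206985295)) (l 135478651))) (n 6 9 (n 5 10 (l 164092272) (l 205213734)) (l
  133707090))) (n 5 10 (n 6 10 (n 5 9 (l 164250672) (l 207733317)) (l 155126873)) (l 154965822)))
  (n 5 9 (n 6 9 (n 7 10 (n 5 10 (l 164265192) (l 188260787)) (l 208756856)) (l 153355312)) (l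
  153194261))))) (n 7 9 (n 5 10 (n 6 8 (n 6 9 (l 168085272) (n 5 9 (l 205287822) (l 133707090)))
  (n 5 8 (n 7 10 (l 189480382) (n 6 10 (l 188554732) (l 155126873))) (l 131935529))) (n 6 10 (n 7
  10 (n 6 8 (l 189495012) (n 5 8 (l 189490172) (l 131935529))) (l 154965822)) (l 135478651))) (n 5
  9 (n 6 9 (n 7 10 (n 6 10 (l 164266512) (n 5 10 (l 164265192) (l 135478651))) (n 5 10 (n 6 10 (n
  5 8 (l 207034952) (n 6 8 (l 205278032) (l 131935529))) (l 155126873)) (l 154965822))) (l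
  153355312)) (l 153194261)))) (l 121292248)) (l 140779298))) (l 140940833)) (l 140940712)) (l
  140940591)) (l 140940228)))))

set_option maxRecDepth 100000 in
theorem check_tree : check tree [] [] = true := by decide +kernel

theorem exists_cycle {n k : ℕ} {α : Type*} (c : Sym2 (Fin n) → Fin k) (p : Fin n → α)
    (c1 c2 : Fin k)
    (h12 : ∀ u w, p u ≠ p w → c s(u, w) = c1 ∨ c s(u, w) = c2)
    (hcongr : ∀ u w u' w', p u = p u' → p w = p w' → p u ≠ p w → c s(u, w) = c s(u', w'))
    (V : ℕ → Fin n) (hinj : ∀ i < 11, ∀ j < 11, V i = V j → i = j)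
    (hrep : ∀ i < 11, p (V i) = p (V (rep i)))
    (hadj : ∀ i < 11, ∀ j < 11, adjLt i j = true → p (V i) ≠ p (V j)) :
    ∃ j : Fin k, hasMonoCycle c 8 j := by
  obtain ⟨b, x, hx, hb⟩ := check_sound
    (fun u w => decide (c s(V u, V w) = c1)) (fun u w => by simp only [Sym2.eq_swap])
    tree [] [] (by simp) (by simp) check_tree
  have hd : ∀ i, dig x i < 11 := fun i => Nat.mod_lt _ (by norm_num)
  have hok : ∀ i < 8, adj (dig x i) (dig x ((i + 1) % 8)) = true ∧
      ∀ j < 8, dig x i = dig x j → i = j := by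
    intro i hi
    have h1 := List.all_eq_true.1 hx i (List.mem_range.2 hi)
    rw [Bool.and_eq_true] at h1
    refine ⟨h1.1, fun j hj hij => ?_⟩
    have h2 := List.all_eq_true.1 h1.2 j (List.mem_range.2 hj)
    simpa [hij] using h2
  refine ⟨if b = true then c1 else c2, fun i => V (dig x i), ?_, ?_⟩
  · intro i j hij
    exact Fin.ext ((hok i i.2).2 j j.2 (hinj _ (hd _) _ (hd _) hij))
  · intro i
    have hne : p (V (dig x i)) ≠ p (V (dig x ((i.val + 1) % 8))) := by
      have h := (hok i i.2).1
      rw [adj, Bool.or_eq_true] at h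
      rcases h with h | h
      · exact hadj _ (hd _) _ (hd _) h
      · exact (hadj _ (hd _) _ (hd _) h).symm
    have hcol := hb i i.2
    have e1 := hcongr _ _ _ _ (hrep _ (hd i)) (hrep _ (hd ((i.val + 1) % 8))) hne
    have e2 := h12 _ _ hne
    simp only at hcol ⊢
    rw [← e1] at hcol
    cases b with
    | true => simpa using hcol
    | false =>
      have : c s(V (dig x i), V (dig x ((i.val + 1) % 8))) ≠ c1 := by simpa using hcol
      simpa [this] using e2

theorem exists_cycle' {n k : ℕ} {α : Type*} (c : Sym2 (Fin n) → Fin k) (p : Fin n → α)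
    (c1 c2 : Fin k)
    (h12 : ∀ u w, p u ≠ p w → c s(u, w) = c1 ∨ c s(u, w) = c2)
    (hcongr : ∀ u w u' w', p u = p u' → p w = p w' → p u ≠ p w → c s(u, w) = c s(u', w'))
    (a0 a1 a2 b0 b1 x0 x1 x2 x3 x4 x5 : Fin n)
    (hnd : [a0, a1, a2, b0, b1, x0, x1, x2, x3, x4, x5].Nodup)
    (ha1 : p a1 = p a0) (ha2 : p a2 = p a0) (hb1 : p b1 = p b0) (hab : p a0 ≠ p b0)
    (hx : ∀ x ∈ [x0, x1, x2, x3, x4, x5], p a0 ≠ p x ∧ p b0 ≠ p x)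
    (h03 : p x0 ≠ p x3) (h04 : p x0 ≠ p x4) (h05 : p x0 ≠ p x5)
    (h13 : p x1 ≠ p x3) (h14 : p x1 ≠ p x4) (h15 : p x1 ≠ p x5)
    (h24 : p x2 ≠ p x4) (h25 : p x2 ≠ p x5) :
    ∃ j : Fin k, hasMonoCycle c 8 j := by
  refine exists_cycle c p c1 c2 h12 hcongr
    (fun i => [a0, a1, a2, b0, b1, x0, x1, x2, x3, x4, x5].getD i a0) ?_ ?_ ?_
  · intro i hi j hj hij
    have hi' : i < [a0, a1, a2, b0, b1, x0, x1, x2, x3, x4, x5].length := hi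
    have hj' : j < [a0, a1, a2, b0, b1, x0, x1, x2, x3, x4, x5].length := hj
    simp only [List.getD_eq_getElem _ _ hi', List.getD_eq_getElem _ _ hj'] at hij
    exact (hnd.getElem_inj_iff).1 hij
  · intro i hi
    interval_cases i <;> simp [rep, ha1, ha2, hb1]
  · simp only [List.mem_cons, List.not_mem_nil, or_false, forall_eq_or_imp, forall_eq] at hx
    obtain ⟨g0, g1, g2, g3, g4, g5⟩ := hx
    intro i hi j hj
    interval_cases i <;> interval_cases j <;> simp [adjLt, *]

end C8Tree

/-- If `c` is a Gallai coloring of `K_n` with a Gallai partition all of whose parts have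
order at most 3, with a part of order 3, another part of order at least 2, and at least
six further vertices outside these two parts, then `c` contains a monochromatic `C₈`. -/
theorem mono_C8_of_part3_part2_six_more (n k : ℕ)
    (c : Sym2 (Fin n) → Fin k) (hrb : ¬ hasRainbowTriangle c)
    (P : Finpartition (Finset.univ : Finset (Fin n))) (hP : IsGallaiPartition c P)
    (hsmall : ∀ A ∈ P.parts, A.card ≤ 3)
    (A B : Finset (Fin n)) (hA : A ∈ P.parts) (hB : B ∈ P.parts) (hAB : A ≠ B)
    (hA3 : A.card = 3) (hB2 : 2 ≤ B.card)
    (hextra : A.card + B.card + 6 ≤ n) :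
    ∃ j : Fin k, hasMonoCycle c 8 j := by
  classical
  obtain ⟨-, c1, c2, hc⟩ := hP
  have hmem : ∀ v : Fin n, v ∈ P.part v := fun v => P.mem_part (Finset.mem_univ v)
  have hpp : ∀ v : Fin n, P.part v ∈ P.parts := fun v => P.part_mem.2 (Finset.mem_univ v)
  have hpart : ∀ C ∈ P.parts, ∀ v ∈ C, P.part v = C := fun C hC v hv =>
    P.part_eq_of_mem hC hv
  have h12 : ∀ u w, P.part u ≠ P.part w → c s(u, w) = c1 ∨ c s(u, w) = c2 := by
    intro u w h
    rcases hc _ (hpp u) _ (hpp w) h with h | h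
    · exact Or.inl (h _ (hmem u) _ (hmem w))
    · exact Or.inr (h _ (hmem u) _ (hmem w))
  have hcongr : ∀ u w u' w', P.part u = P.part u' → P.part w = P.part w' →
      P.part u ≠ P.part w → c s(u, w) = c s(u', w') := by
    intro u w u' w' hu hw h
    have hu' : u' ∈ P.part u := hu ▸ hmem u'
    have hw' : w' ∈ P.part w := hw ▸ hmem w'
    rcases hc _ (hpp u) _ (hpp w) h with h | h
    · rw [h _ (hmem u) _ (hmem w), h _ hu' _ hw']
    · rw [h _ (hmem u) _ (hmem w), h _ hu' _ hw']
  obtain ⟨a0, a1, a2, ha01, ha02, ha12, hAeq⟩ := Finset.card_eq_three.1 hA3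
  obtain ⟨b0, hb0, b1, hb1, hb01⟩ := Finset.one_lt_card.1 hB2
  have hcard : 6 ≤ (Finset.univ \ (A ∪ B)).card := by
    have h1 := Finset.card_union_le A B
    have h2 := Finset.le_card_sdiff (A ∪ B) (Finset.univ : Finset (Fin n))
    rw [Finset.card_univ, Fintype.card_fin] at h2
    omega
  obtain ⟨X, hX, hX6⟩ := Finset.exists_subset_card_eq hcard
  let key : Fin n → Fin n := fun v => (P.part v).min' ⟨v, hmem v⟩
  have hkey : ∀ u w, key u = key w ↔ P.part u = P.part w := by
    intro u w
    constructor
    · intro h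
      have h1 : key u ∈ P.part u := Finset.min'_mem _ _
      have h2 : key w ∈ P.part w := Finset.min'_mem _ _
      rw [← hpart _ (hpp u) _ h1, h, hpart _ (hpp w) _ h2]
    · intro h
      simp only [key, h]
  let x' : Fin 6 → Fin n := fun i => X.orderEmbOfFin hX6 i
  let x : Fin 6 → Fin n := x' ∘ Tuple.sort (key ∘ x')
  have hxinj : Function.Injective x :=
    (X.orderEmbOfFin hX6).injective.comp (Equiv.injective _)
  have hxmem : ∀ i, x i ∈ X := fun i => Finset.orderEmbOfFin_mem X hX6 _
  have hmono : Monotone (fun i => key (x i)) := Tuple.monotone_sort (key ∘ x')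
  have hxnd : [x 0, x 1, x 2, x 3, x 4, x 5].Nodup := by
    have := List.nodup_ofFn.2 hxinj
    simpa [List.ofFn_succ] using this
  have four : ∀ i j l m : Fin 6, i < j → j < l → l < m → key (x i) ≠ key (x m) := by
    intro i j l m hij hjl hlm h
    have hj : key (x j) = key (x i) :=
      le_antisymm ((hmono (hjl.trans hlm).le).trans h.symm.le) (hmono hij.le)
    have hl : key (x l) = key (x i) :=
      le_antisymm ((hmono hlm.le).trans h.symm.le) (hmono (hij.trans hjl).le)
    have hs : ({x i, x j, x l, x m} : Finset (Fin n)) ⊆ P.part (x i) := by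
      intro v hv
      simp only [Finset.mem_insert, Finset.mem_singleton] at hv
      rcases hv with rfl | rfl | rfl | rfl
      · exact hmem _
      · rw [← (hkey _ _).1 hj]; exact hmem _
      · rw [← (hkey _ _).1 hl]; exact hmem _
      · rw [(hkey _ _).1 h]; exact hmem _
    have h4 : ({x i, x j, x l, x m} : Finset (Fin n)).card = 4 := by
      have n1 := hxinj.ne hij.ne
      have n2 := hxinj.ne (hij.trans hjl).ne
      have n3 := hxinj.ne ((hij.trans hjl).trans hlm).ne
      have n4 := hxinj.ne hjl.ne
      have n5 := hxinj.ne (hjl.trans hlm).ne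
      have n6 := hxinj.ne hlm.ne
      rw [Finset.card_insert_of_notMem (by simp [*]), Finset.card_insert_of_notMem (by simp [*]),
        Finset.card_insert_of_notMem (by simp [*]), Finset.card_singleton]
    have := Finset.card_le_card hs
    have := hsmall _ (hpp (x i))
    omega
  have ha0 : a0 ∈ A := by simp [hAeq]
  have ha1 : a1 ∈ A := by simp [hAeq]
  have ha2 : a2 ∈ A := by simp [hAeq]
  have pa0 := hpart A hA a0 ha0
  have pa1 := hpart A hA a1 ha1
  have pa2 := hpart A hA a2 ha2
  have pb0 := hpart B hB b0 hb0
  have pb1 := hpart B hB b1 hb1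
  have key3 : ∀ y0 y1 y2 y3 y4 y5 : Fin 6, [y0, y1, y2, y3, y4, y5].Nodup →
      key (x y0) ≠ key (x y3) → key (x y0) ≠ key (x y4) → key (x y0) ≠ key (x y5) →
      key (x y1) ≠ key (x y3) → key (x y1) ≠ key (x y4) → key (x y1) ≠ key (x y5) →
      key (x y2) ≠ key (x y4) → key (x y2) ≠ key (x y5) →
      ∃ j : Fin k, hasMonoCycle c 8 j := by
    intro y0 y1 y2 y3 y4 y5 hnd h03 h04 h05 h13 h14 h15 h24 h25
    simp only [ne_eq, hkey] at h03 h04 h05 h13 h14 h15 h24 h25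
    have hxA : ∀ y, P.part (x y) ≠ A ∧ P.part (x y) ≠ B := by
      intro y
      have h := hX (hxmem y)
      simp only [Finset.mem_sdiff, Finset.mem_union, not_or] at h
      exact ⟨fun e => h.2.1 (e ▸ hmem (x y)), fun e => h.2.2 (e ▸ hmem (x y))⟩
    refine C8Tree.exists_cycle' c P.part c1 c2 h12 hcongr a0 a1 a2 b0 b1
      (x y0) (x y1) (x y2) (x y3) (x y4) (x y5) ?_ (pa1.trans pa0.symm) (pa2.trans pa0.symm)
      (pb1.trans pb0.symm) (by rw [pa0, pb0]; exact hAB) ?_ h03 h04 h05 h13 h14 h15 h24 h25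
    · have hl : [x y0, x y1, x y2, x y3, x y4, x y5].Nodup := hnd.map hxinj
      have dAB : ∀ u ∈ A, ∀ w ∈ B, u ≠ w := by
        rintro u hu w hw rfl
        exact hAB ((hpart A hA u hu).symm.trans (hpart B hB u hw))
      have dAX : ∀ u ∈ A, ∀ y, u ≠ x y := by
        rintro u hu y rfl
        exact (hxA y).1 (hpart A hA _ hu)
      have dBX : ∀ u ∈ B, ∀ y, u ≠ x y := by
        rintro u hu y rfl
        exact (hxA y).2 (hpart B hB _ hu)
      have q1 := dAB a0 ha0 b0 hb0
      have q2 := dAB a0 ha0 b1 hb1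
      have q3 := dAB a1 ha1 b0 hb0
      have q4 := dAB a1 ha1 b1 hb1
      have q5 := dAB a2 ha2 b0 hb0
      have q6 := dAB a2 ha2 b1 hb1
      have r0 := dAX a0 ha0
      have r1 := dAX a1 ha1
      have r2 := dAX a2 ha2
      have r3 := dBX b0 hb0
      have r4 := dBX b1 hb1
      refine List.nodup_cons.2 ⟨by simp [*], List.nodup_cons.2 ⟨by simp [*],
        List.nodup_cons.2 ⟨by simp [*], List.nodup_cons.2 ⟨by simp [*],
        List.nodup_cons.2 ⟨by simp [*], hl⟩⟩⟩⟩⟩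
    · intro v hv
      have : ∃ y, v = x y := by
        simp only [List.mem_cons, List.not_mem_nil, or_false] at hv
        rcases hv with h | h | h | h | h | h <;> exact ⟨_, h⟩
      obtain ⟨y, rfl⟩ := this
      rw [pa0, pb0]
      exact ⟨(hxA y).1.symm, (hxA y).2.symm⟩
  have f03 := four 0 1 2 3 (by decide) (by decide) (by decide)
  have f04 := four 0 1 2 4 (by decide) (by decide) (by decide)
  have f05 := four 0 1 2 5 (by decide) (by decide) (by decide)
  have f14 := four 1 2 3 4 (by decide) (by decide) (by decide)
  have f15 := four 1 2 3 5 (by decide) (by decide) (by decide)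
  have f25 := four 2 3 4 5 (by decide) (by decide) (by decide)
  have m12 : key (x 1) ≤ key (x 2) := hmono (by decide)
  have m23 : key (x 2) ≤ key (x 3) := hmono (by decide)
  have m34 : key (x 3) ≤ key (x 4) := hmono (by decide)
  by_cases e13 : key (x 1) = key (x 3)
  · have e2 : key (x 2) = key (x 3) := le_antisymm m23 (e13 ▸ m12)
    exact key3 0 4 5 1 2 3 (by decide) (by rw [e13]; exact f03) (by rw [e2]; exact f03) f03
      f14.symm (by rw [e2, ← e13]; exact f14.symm) (by rw [← e13]; exact f14.symm)
      (by rw [e2, ← e13]; exact f15.symm) (by rw [← e13]; exact f15.symm)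
  by_cases e24 : key (x 2) = key (x 4)
  · have e3 : key (x 3) = key (x 4) := le_antisymm m34 (e24 ▸ m23)
    exact key3 0 1 5 2 3 4 (by decide) (by rw [e24]; exact f04) f03 f04
      (by rw [e24]; exact f14) (by rw [e3]; exact f14) f14
      (by rw [e3, ← e24]; exact f25.symm) (by rw [← e24]; exact f25.symm)
  exact key3 0 1 2 3 4 5 (by decide) f03 f04 f05 e13 f14 f15 e24 f25
end

section
/- For every integer k ≥ 2, gr_k(K_3 : P_7, P_5, P_3, ..., P_3) = 8, where P_7 is sought in color 1, P_5 in color 2, and P_3 in each of the other k − 2 colors. That is, for every n ≥ 8, every edge-coloring of K_n with colors 1, ..., k contains either a rainbow triangle, or a path on 7 vertices monochromatic in color 1, or a path on 5 vertices monochromatic in color 2, or a path on 3 vertices monochromatic in some color j ≥ 3; and this fails for n = 7. -/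
/-- A vertex outside a short list. -/
lemma exists_outside {n : ℕ} (l : List (Fin n)) (h : l.length < n) : ∃ x, x ∉ l := by
  by_contra hc
  push Not at hc
  have h1 : (Finset.univ : Finset (Fin n)) ⊆ l.toFinset := fun x _ => by simpa using hc x
  have h2 := Finset.card_le_card h1
  have h3 := List.toFinset_card_le l
  simp at h2
  omega

/-- Abstract form of the coloring: red, blue, and a matching of twins. -/
structure Good {V : Type} (R B M : V → V → Prop) : Prop where
  rs : ∀ a b, R a b → R b a
  bs : ∀ a b, B a b → B b a
  ms : ∀ a b, M a b → M b a
  cov : ∀ a b, a ≠ b → R a b ∨ B a b ∨ M a b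
  rb : ∀ a b, R a b → ¬ B a b
  mm : ∀ a b d, a ≠ b → a ≠ d → M a b → M a d → b = d
  tw : ∀ a b d, a ≠ b → a ≠ d → b ≠ d → M a b → B a d → B b d
  nb : ∀ a b d e f, [a, b, d, e, f].Nodup → B a b → B b d → B d e → B e f → False

lemma Good.c4 {V : Type} {R B M : V → V → Prop} (g : Good R B M) (x y v w : V)
    (hd : [x, y, v, w].Nodup) (h1 : ¬ R x v) (h2 : ¬ R x w) (h3 : ¬ R y v) (h4 : ¬ R y w) :
    (B x v ∧ B v y ∧ B y w ∧ B w x) ∨ (B x y ∧ B y v ∧ B v w ∧ B w x)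
     ∨ (B y x ∧ B x v ∧ B v w ∧ B w y) := by
  simp only [List.nodup_cons, List.mem_cons, List.not_mem_nil, or_false, not_or] at hd
  obtain ⟨⟨xy, xv, xw⟩, ⟨yv, yw⟩, vw, -⟩ := hd
  have c1 := g.cov x v xv
  have c2 := g.cov x w xw
  have c3 := g.cov y v yv
  have c4 := g.cov y w yw
  have := g.mm
  have := g.tw
  have := g.ms
  have := g.bs
  grind

lemma Good.out {V : Type} {R B M : V → V → Prop} (g : Good R B M) (x y v w : V)
    (hd : [x, y, v, w].Nodup) (h1 : ¬ R x v) (h2 : ¬ R x w) (h3 : ¬ R y v) (h4 : ¬ R y w)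
    (z : V) (hz : z ∉ [x, y, v, w]) : ¬ B z x ∧ ¬ B z y ∧ ¬ B z v ∧ ¬ B z w := by
  have key : ∀ p q r s : V, [p, q, r, s].Perm [x, y, v, w] → B p q → B q r → B r s → B s p →
      ¬ B z x ∧ ¬ B z y ∧ ¬ B z v ∧ ¬ B z w := by
    intro p q r s hp pq qr rs sp
    have hn := hp.nodup_iff.mpr hd
    have hz' : z ∉ [p, q, r, s] := fun h => hz (hp.mem_iff.mp h)
    have all : ∀ u ∈ [p, q, r, s], ¬ B z u := by
      intro u hu hb
      simp only [List.mem_cons, List.not_mem_nil, or_false] at hu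
      simp only [List.nodup_cons, List.mem_cons, List.not_mem_nil, or_false, not_or] at hn hz'
      rcases hu with rfl | rfl | rfl | rfl
      · exact g.nb z u q r s (by simp; grind) hb pq qr rs
      · exact g.nb z u r s p (by simp; grind) hb qr rs sp
      · exact g.nb z u s p q (by simp; grind) hb rs sp pq
      · exact g.nb z u p q r (by simp; grind) hb sp pq qr
    exact ⟨all x (hp.mem_iff.mpr (by simp)), all y (hp.mem_iff.mpr (by simp)),
      all v (hp.mem_iff.mpr (by simp)), all w (hp.mem_iff.mpr (by simp))⟩
  rcases g.c4 x y v w hd h1 h2 h3 h4 with ⟨a, b, c, d⟩ | ⟨a, b, c, d⟩ | ⟨a, b, c, d⟩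
  · refine key x v y w ?_ a b c d
    exact List.Perm.cons _ (List.Perm.swap _ _ _)
  · exact key x y v w (List.Perm.refl _) a b c d
  · exact key y x v w (List.Perm.swap _ _ _) a b c d

/-- Three outsiders cannot all be non-red to both ends. -/
lemma Good.three {V : Type} {R B M : V → V → Prop} (g : Good R B M) (x y z v w : V)
    (hd : [x, y, z, v, w].Nodup) (h1 : ¬ R x v) (h2 : ¬ R x w) (h3 : ¬ R y v) (h4 : ¬ R y w)
    (h5 : ¬ R z v) (h6 : ¬ R z w) : False := by
  have hd' := hd
  simp only [List.nodup_cons, List.mem_cons, List.not_mem_nil, or_false, not_or] at hd'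
  obtain ⟨-, -, b, d⟩ := g.out x y v w (by simp; grind) h1 h2 h3 h4 z (by simp; grind)
  have c1 := g.cov z v (by grind)
  have c2 := g.cov z w (by grind)
  have := g.mm z v w
  grind

lemma Good.last {V : Type} {R B M : V → V → Prop} (g : Good R B M) (x y a b c d e f : V)
    (hd : [x, y, a, b, c, d, e, f].Nodup) (h1 : ¬ R x a) (h2 : ¬ R x f) (h3 : ¬ R y a)
    (h4 : ¬ R y f) (k1 : ¬ (R x b ∧ R x c)) (k2 : ¬ (R x d ∧ R x e)) : False := by
  simp only [List.nodup_cons, List.mem_cons, List.not_mem_nil, or_false, not_or] at hd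
  have o := fun z hz => (g.out x y a f (by simp; grind) h1 h2 h3 h4 z hz).1
  have ob := o b (by simp; grind)
  have oc := o c (by simp; grind)
  have od := o d (by simp; grind)
  have oe := o e (by simp; grind)
  have cb := g.cov x b (by grind)
  have cc := g.cov x c (by grind)
  have cd := g.cov x d (by grind)
  have ce := g.cov x e (by grind)
  have := g.mm x
  have := g.bs
  grind

/-- Red paths given by lists extend. -/
lemma Good.ext {n : ℕ} {R B M : Fin n → Fin n → Prop} (g : Good R B M) (v w : Fin n)
    (l : List (Fin n)) (hvw : v ≠ w) (hv : v ∈ l) (hw : w ∈ l) (hl : l.length + 3 ≤ n) :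
    ∃ x, x ∉ l ∧ (R x v ∨ R x w) := by
  by_contra hc
  push Not at hc
  obtain ⟨x, hx⟩ := exists_outside l (by omega)
  obtain ⟨y, hy⟩ := exists_outside (x :: l) (by simp; omega)
  obtain ⟨z, hz⟩ := exists_outside (y :: x :: l) (by simp; omega)
  simp only [List.mem_cons, not_or] at hy hz
  refine g.three x y z v w ?_ (hc x hx).1 (hc x hx).2 (hc y hy.2).1 (hc y hy.2).2
    (hc z hz.2.2).1 (hc z hz.2.2).2
  simp only [List.nodup_cons, List.mem_cons, List.not_mem_nil, or_false, not_or]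
  grind

lemma Good.red2 {n : ℕ} (hn : 8 ≤ n) {R B M : Fin n → Fin n → Prop} (g : Good R B M) :
    ∃ a b, a ≠ b ∧ R a b := by
  by_contra hc
  push Not at hc
  have step : ∀ (a : Fin n) (l : List (Fin n)), a ∈ l → l.length + 1 < n →
      ∃ b, b ∉ l ∧ B a b := by
    intro a l ha hl
    obtain ⟨x, hx⟩ := exists_outside l (by omega)
    obtain ⟨y, hy⟩ := exists_outside (x :: l) (by simp; omega)
    simp only [List.mem_cons, not_or] at hy
    have h1 : a ≠ x := by grind
    have h2 : a ≠ y := by grind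
    have := g.cov a x h1
    have := g.cov a y h2
    have := g.mm a x y h1 h2
    have := hc a x h1
    have := hc a y h2
    grind
  obtain ⟨b, hb, ab⟩ := step ⟨0, by omega⟩ [⟨0, by omega⟩] (by simp) (by simp; omega)
  obtain ⟨c, hc', bc⟩ := step b [b, ⟨0, by omega⟩] (by simp) (by simp; omega)
  obtain ⟨d, hd, cd⟩ := step c [c, b, ⟨0, by omega⟩] (by simp) (by simp; omega)
  obtain ⟨e, he, de⟩ := step d [d, c, b, ⟨0, by omega⟩] (by simp) (by simp; omega)
  refine g.nb _ _ _ _ _ ?_ ab bc cd de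
  simp only [List.nodup_cons, List.mem_cons, List.not_mem_nil, or_false, not_or] at *
  grind

lemma Good.red7 {n : ℕ} (hn : 8 ≤ n) {R B M : Fin n → Fin n → Prop} (g : Good R B M) :
    ∃ l : List (Fin n), l.length = 7 ∧ l.Nodup ∧ l.IsChain R := by
  have r2 : ∃ l : List (Fin n), l.length = 2 ∧ l.Nodup ∧ l.IsChain R := by
    obtain ⟨a, b, h, r⟩ := g.red2 hn
    exact ⟨[a, b], rfl, by simpa using h, by simpa using r⟩
  have step : ∀ m, 2 ≤ m → m ≤ 5 → (∃ l : List (Fin n), l.length = m ∧ l.Nodup ∧ l.IsChain R) →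
      ∃ l : List (Fin n), l.length = m + 1 ∧ l.Nodup ∧ l.IsChain R := by
    rintro m h2 h5 ⟨l, hl, hnd, hch⟩
    have hne : l ≠ [] := by rintro rfl; simp at hl; omega
    have hvw : l.head hne ≠ l.getLast hne := by
      intro h
      rw [List.head_eq_getElem, List.getLast_eq_getElem, hnd.getElem_inj_iff] at h
      omega
    obtain ⟨x, hx, hr⟩ := g.ext (l.head hne) (l.getLast hne) l hvw (List.head_mem _)
      (List.getLast_mem _) (by omega)
    rcases hr with hr | hr
    · refine ⟨x :: l, by simp [hl], by simp [hx, hnd], ?_⟩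
      rw [List.isChain_cons]
      refine ⟨?_, hch⟩
      intro y hy
      rw [List.head?_eq_some_head hne] at hy
      simp at hy
      exact hy ▸ hr
    · refine ⟨l ++ [x], by simp [hl], ?_, ?_⟩
      · rw [List.nodup_append]
        refine ⟨hnd, by simp, ?_⟩
        intro a ha b hb
        simp at hb
        rintro rfl
        exact hx (hb ▸ ha)
      · rw [List.isChain_append]
        refine ⟨hch, by simp, ?_⟩
        intro y hy z hz
        rw [List.getLast?_eq_some_getLast hne] at hy
        simp at hy hz
        subst hy hz
        exact g.rs _ _ hr
  obtain ⟨l, hl, hnd, hch⟩ := step 5 (by norm_num) (by norm_num) (step 4 (by norm_num) (by norm_num)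
    (step 3 (by norm_num) (by norm_num) (step 2 (by norm_num) (by norm_num) r2)))
  match l, hl, hnd, hch with
  | [a, b, c, d, e, f], _, hnd, hch =>
    obtain ⟨x, hx⟩ := exists_outside [a, b, c, d, e, f] (by simp; omega)
    obtain ⟨y, hy⟩ := exists_outside [x, a, b, c, d, e, f] (by simp; omega)
    by_contra hcon
    have no : ∀ l : List (Fin n), l.length = 7 → l.Nodup → l.IsChain R → False :=
      fun l h1 h2 h3 => hcon ⟨l, h1, h2, h3⟩
    simp only [List.isChain_cons_cons, List.isChain_singleton, and_true] at hch
    obtain ⟨ab, bc, cd, de, ef⟩ := hch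
    have rs := g.rs
    simp only [List.nodup_cons, List.mem_cons, List.not_mem_nil, or_false, not_or] at hnd hx hy
    have ends : ∀ z, z ∉ [a, b, c, d, e, f] → ¬ R z a ∧ ¬ R z f := by
      intro z hz
      simp only [List.mem_cons, List.not_mem_nil, or_false, not_or] at hz
      constructor
      · intro h
        refine no [z, a, b, c, d, e, f] rfl ?_ (by simp [*])
        simp only [List.nodup_cons, List.mem_cons, List.not_mem_nil, or_false, not_or]
        grind
      · intro h
        refine no [z, f, e, d, c, b, a] rfl ?_ ?_
        · simp only [List.nodup_cons, List.mem_cons, List.not_mem_nil, or_false, not_or]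
          grind
        · simp only [List.isChain_cons_cons, List.isChain_singleton, and_true]
          grind
    have ex := ends x (by simp; grind)
    have ey := ends y (by simp; grind)
    refine g.last x y a b c d e f ?_ ex.1 ex.2 ey.1 ey.2 ?_ ?_
    · simp only [List.nodup_cons, List.mem_cons, List.not_mem_nil, or_false, not_or]
      grind
    · rintro ⟨h1, h2⟩
      refine no [a, b, x, c, d, e, f] rfl ?_ ?_
      · simp only [List.nodup_cons, List.mem_cons, List.not_mem_nil, or_false, not_or]
        grind
      · simp only [List.isChain_cons_cons, List.isChain_singleton, and_true]
        grind
    · rintro ⟨h1, h2⟩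
      refine no [a, b, c, d, x, e, f] rfl ?_ ?_
      · simp only [List.nodup_cons, List.mem_cons, List.not_mem_nil, or_false, not_or]
        grind
      · simp only [List.isChain_cons_cons, List.isChain_singleton, and_true]
        grind

lemma monoPath_of_list {n k : ℕ} (c : Sym2 (Fin n) → Fin k) (m : ℕ) (j : Fin k)
    (l : List (Fin n)) (hl : l.length = m) (hnd : l.Nodup)
    (hch : l.IsChain (fun a b => c s(a, b) = j)) : hasMonoPath c m j := by
  subst hl
  refine ⟨fun i => l[i], ?_, ?_⟩
  · intro i i' h
    exact Fin.ext (hnd.getElem_inj_iff.mp h)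
  · intro i h
    exact List.isChain_iff_getElem.mp hch i h

lemma upper {k : ℕ} (hk : 2 ≤ k) (n : ℕ) (hn : 8 ≤ n) (c : Sym2 (Fin n) → Fin k) :
    hasRainbowTriangle c ∨ hasMonoPath c 7 ⟨0, Nat.lt_of_lt_of_le Nat.zero_lt_two hk⟩ ∨
        hasMonoPath c 5 ⟨1, hk⟩ ∨
        ∃ j : Fin k, j.val ≥ 2 ∧ hasMonoPath c 3 j := by
  by_contra hcon
  push Not at hcon
  obtain ⟨hrt, h7, h5, h3⟩ := hcon
  have rt : ∀ a b d : Fin n, a ≠ b → a ≠ d → b ≠ d → c s(a, b) = c s(a, d) ∨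
      c s(a, b) = c s(b, d) ∨ c s(a, d) = c s(b, d) := by
    intro a b d h1 h2 h4
    by_contra hh
    push Not at hh
    exact hrt ⟨a, b, d, h1, h2, h4, hh⟩
  have p3 : ∀ a b d : Fin n, a ≠ b → a ≠ d → b ≠ d → (c s(a, b)).val ≥ 2 →
      c s(a, b) ≠ c s(a, d) := by
    intro a b d h1 h2 h4 hv he
    refine h3 _ hv (monoPath_of_list c 3 _ [b, a, d] rfl ?_ ?_)
    · simp; grind
    · simp [he, Sym2.eq_swap]
  have sy : ∀ a b : Fin n, c s(a, b) = c s(b, a) := fun a b => by rw [Sym2.eq_swap]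
  have g : Good (fun a b => c s(a, b) = ⟨0, Nat.lt_of_lt_of_le Nat.zero_lt_two hk⟩)
      (fun a b => c s(a, b) = ⟨1, hk⟩) (fun a b => (c s(a, b)).val ≥ 2) := by
    refine ⟨?_, ?_, ?_, ?_, ?_, ?_, ?_, ?_⟩
    · intro a b h; rw [sy]; exact h
    · intro a b h; rw [sy]; exact h
    · intro a b h; rw [sy]; exact h
    · intro a b _
      simp only [Fin.ext_iff]
      omega
    · intro a b h h'
      simp [Fin.ext_iff] at h h'
      omega
    · intro a b d h1 h2 m1 m2
      by_contra h4
      have := rt a b d h1 h2 h4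
      have := p3 a b d h1 h2 h4 m1
      have := p3 b a d h1.symm h4 h2 (by rw [sy]; exact m1)
      have := p3 d a b h2.symm (Ne.symm h4) h1 (by rw [sy]; exact m2)
      have := sy a b
      have := sy a d
      have := sy b d
      grind
    · intro a b d h1 h2 h4 m1 hb
      have := rt a b d h1 h2 h4
      have := p3 a b d h1 h2 h4 m1
      have := p3 b a d h1.symm h4 h2 (by rw [sy]; exact m1)
      have := sy a b
      grind
    · intro a b d e f hnd h1 h2 h4 h6
      exact h5 (monoPath_of_list c 5 _ [a, b, d, e, f] rfl hnd (by simp [*]))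
  obtain ⟨l, hl, hnd, hch⟩ := g.red7 hn
  exact h7 (monoPath_of_list c 7 _ l hl hnd hch)

lemma lower {k : ℕ} (hk : 2 ≤ k) : ∃ c : Sym2 (Fin 7) → Fin k,
      ¬ hasRainbowTriangle c ∧ ¬ hasMonoPath c 7 ⟨0, Nat.lt_of_lt_of_le Nat.zero_lt_two hk⟩ ∧
        ¬ hasMonoPath c 5 ⟨1, hk⟩ ∧
        ∀ j : Fin k, j.val ≥ 2 → ¬ hasMonoPath c 3 j := by
  classical
  refine ⟨fun e => if (6 : Fin 7) ∈ e then ⟨1, hk⟩ else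
    ⟨0, Nat.lt_of_lt_of_le Nat.zero_lt_two hk⟩, ?_, ?_, ?_, ?_⟩
  · rintro ⟨a, b, d, -, -, -, h1, h2, h3⟩
    grind
  · rintro ⟨v, hv, h⟩
    obtain ⟨i, hi⟩ := (Finite.injective_iff_surjective.mp hv) 6
    have key : ∀ j (hj : j + 1 < 7), (6 : Fin 7) ∉ s(v ⟨j, Nat.lt_of_succ_lt hj⟩, v ⟨j + 1, hj⟩) := by
      intro j hj hm
      have := h j hj
      simp only [if_pos hm, Fin.ext_iff] at this
      omega
    by_cases h6 : i.val + 1 < 7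
    · exact key i.val h6 (by simp [hi])
    · have : i = ⟨5 + 1, by norm_num⟩ := Fin.ext (by simp; omega)
      exact key 5 (by norm_num) (by rw [← this, hi]; simp)
  · rintro ⟨v, hv, h⟩
    have key : ∀ j (hj : j + 1 < 5), (6 : Fin 7) ∈ s(v ⟨j, Nat.lt_of_succ_lt hj⟩, v ⟨j + 1, hj⟩) := by
      intro j hj
      by_contra hm
      have := h j hj
      simp only [if_neg hm, Fin.ext_iff] at this
      omega
    have a := key 0 (by norm_num)
    have b := key 2 (by norm_num)
    rw [Sym2.mem_iff] at a b
    rcases a with a | a <;> rcases b with b | b <;>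
      · have := hv (a.symm.trans b)
        simp [Fin.ext_iff] at this
  · rintro j hj ⟨v, -, h⟩
    have := h 0 (by norm_num)
    simp only [Fin.ext_iff] at this
    split_ifs at this <;> simp at this <;> omega

/-- For `k ≥ 2`, `gr_k(K_3 : P₇, P₅, P₃, …, P₃) = 8`: every coloring of `K_n` with colors
`Fin k` for `n ≥ 8` contains a rainbow triangle, a `P₇` monochromatic in color `0`, a `P₅`
monochromatic in color `1`, or a `P₃` monochromatic in some color `j ∉ {0, 1}`; and this
fails for `n = 7`. -/
theorem gallai_ramsey_P7_P5_P3 (k : ℕ) (hk : 2 ≤ k) :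
    (∀ n, 8 ≤ n → ∀ c : Sym2 (Fin n) → Fin k,
      hasRainbowTriangle c ∨ hasMonoPath c 7 ⟨0, Nat.lt_of_lt_of_le Nat.zero_lt_two hk⟩ ∨
        hasMonoPath c 5 ⟨1, hk⟩ ∨
        ∃ j : Fin k, j.val ≥ 2 ∧ hasMonoPath c 3 j) ∧
    (∃ c : Sym2 (Fin 7) → Fin k,
      ¬ hasRainbowTriangle c ∧ ¬ hasMonoPath c 7 ⟨0, Nat.lt_of_lt_of_le Nat.zero_lt_two hk⟩ ∧
        ¬ hasMonoPath c 5 ⟨1, hk⟩ ∧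
        ∀ j : Fin k, j.val ≥ 2 → ¬ hasMonoPath c 3 j) := by
  exact ⟨fun n hn c => upper hk n hn c, lower hk⟩
end
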